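/- arXiv:1211.5674 — 4 statements merged into one kernel-verified Lean document; each statement's English description precedes it below -/
import Mathlib

section
/- Let A be a commutative algebra over a field K of characteristic zero and let X be a generating sequence of K-linear derivations of A. Then for every s ≥ 0 and all f, g ∈ A one has E^X_s(f·g) = Σ_{m=0}^{s} (E^X_m f)·(E^X_{s−m} g); that is, the Lie transform T_X preserves products. -/
open Finset

variable {K : Type*} [Field K] [CharZero K]

/-- The operators `E^X_s` of the Lie transform:
`E_0 = 1`, `E_s = (1/s) ∑_{j=1}^{s} j • (L j ∘ E_{s-j})` (`L j` is the `j`-th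
operator of the generating sequence; `L 0` is unused). -/
noncomputable def Eseq {V : Type*} [AddCommGroup V] [Module K V]
    (L : ℕ → Module.End K V) : ℕ → Module.End K V
  | 0 => 1
  | s + 1 => ((s + 1 : K))⁻¹ • ∑ j ∈ Finset.range (s + 1),
      ((j + 1 : K)) • (L (j + 1) * Eseq L (s - j))
  termination_by s => s
  decreasing_by omega

/-- The recursion for `Eseq`, cleared of denominators and written over the antidiagonal. -/
theorem smul_Eseq_apply {V : Type*} [AddCommGroup V] [Module K V]
    (L : ℕ → Module.End K V) (s : ℕ) (v : V) :
    (s : K) • Eseq L s v =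
      ∑ p ∈ antidiagonal s, (p.1 : K) • L p.1 (Eseq L p.2 v) := by
  cases s with
  | zero => simp
  | succ s =>
    have hs : (s + 1 : K) ≠ 0 := by exact_mod_cast s.succ_ne_zero
    rw [Eseq, Nat.cast_succ, LinearMap.smul_apply, smul_inv_smul₀ hs,
      Finset.Nat.sum_antidiagonal_succ, Finset.Nat.sum_antidiagonal_eq_sum_range_succ_mk]
    simp [LinearMap.sum_apply]

/-- Both sums run over the triples of natural numbers with sum `n`. -/
theorem sum_antidiagonal_antidiagonal_assoc {M : Type*} [AddCommMonoid M] (n : ℕ)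
    (F : ℕ → ℕ → ℕ → M) :
    ∑ p ∈ antidiagonal n, ∑ q ∈ antidiagonal p.1, F q.1 q.2 p.2 =
      ∑ p ∈ antidiagonal n, ∑ q ∈ antidiagonal p.2, F p.1 q.1 q.2 := by
  rw [sum_sigma', sum_sigma']
  refine sum_nbij' (fun x => ⟨(x.2.1, x.2.2 + x.1.2), (x.2.2, x.1.2)⟩)
    (fun x => ⟨(x.1.1 + x.2.1, x.2.2), (x.1.1, x.2.1)⟩) ?_ ?_ ?_ ?_ ?_
  all_goals
    rintro ⟨⟨a, b⟩, ⟨c, d⟩⟩ h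
    simp only [mem_sigma, HasAntidiagonal.mem_antidiagonal] at h
    obtain ⟨rfl, rfl⟩ := h
    simp [add_assoc]

/-- Both sums run over the triples of natural numbers with sum `n`. -/
theorem sum_antidiagonal_antidiagonal_left_comm {M : Type*} [AddCommMonoid M] (n : ℕ)
    (F : ℕ → ℕ → ℕ → M) :
    ∑ p ∈ antidiagonal n, ∑ q ∈ antidiagonal p.2, F p.1 q.1 q.2 =
      ∑ p ∈ antidiagonal n, ∑ q ∈ antidiagonal p.2, F q.1 p.1 q.2 := by
  rw [← sum_antidiagonal_antidiagonal_assoc, ← sum_antidiagonal_antidiagonal_assoc n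
    fun a b c => F b a c]
  refine sum_congr rfl fun p _ => ?_
  exact (Finset.Nat.sum_antidiagonal_swap (f := fun q => F q.1 q.2 p.2)).symm

theorem Eseq_derivation_mul {A : Type*} [CommRing A] [Algebra K A]
    (X : ℕ → Derivation K A A) (s : ℕ) (f g : A) :
    Eseq (fun j => (X j).toLinearMap) s (f * g) =
      ∑ p ∈ antidiagonal s,
        Eseq (fun j => (X j).toLinearMap) p.1 f *
          Eseq (fun j => (X j).toLinearMap) p.2 g := by
  induction s using Nat.strong_induction_on with
  | _ s ih =>
  set E := Eseq fun j => (X j).toLinearMap with hE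
  have hrec (n : ℕ) (v : A) :
      (n : K) • E n v = ∑ p ∈ antidiagonal n, (p.1 : K) • X p.1 (E p.2 v) :=
    smul_Eseq_apply _ n v
  rcases Nat.eq_zero_or_pos s with rfl | hs
  · simp [hE, Eseq]
  have hsK : (s : K) ≠ 0 := by exact_mod_cast hs.ne'
  refine smul_right_injective A hsK ?_
  calc (s : K) • E s (f * g)
      = ∑ p ∈ antidiagonal s, ∑ q ∈ antidiagonal p.2,
          ((p.1 : K) • (X p.1 (E q.1 f) * E q.2 g) +
            (p.1 : K) • (E q.1 f * X p.1 (E q.2 g))) := by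
        rw [hrec]
        refine sum_congr rfl fun p hp => ?_
        rcases Nat.eq_zero_or_pos p.1 with h0 | h0
        · simp [h0]
        rw [ih p.2 (by have := mem_antidiagonal.mp hp; omega), map_sum, smul_sum]
        refine sum_congr rfl fun q _ => ?_
        rw [Derivation.leibniz, smul_eq_mul, smul_eq_mul, ← smul_add, add_comm,
          mul_comm (E q.2 g)]
    _ = ∑ p ∈ antidiagonal s, (((p.1 : K) • E p.1 f) * E p.2 g +
          E p.1 f * ((p.2 : K) • E p.2 g)) := by
        simp only [sum_add_distrib, hrec, sum_mul, mul_sum, smul_mul_assoc, mul_smul_comm]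
        rw [sum_antidiagonal_antidiagonal_assoc s
            fun a b c => (a : K) • (X a (E b f) * E c g),
          sum_antidiagonal_antidiagonal_left_comm s
            fun a b c => (a : K) • (E b f * X a (E c g))]
    _ = (s : K) • ∑ p ∈ antidiagonal s, E p.1 f * E p.2 g := by
        rw [smul_sum]
        refine sum_congr rfl fun p hp => ?_
        rw [smul_mul_assoc, mul_smul_comm, ← add_smul, ← Nat.cast_add, mem_antidiagonal.mp hp]

/-- for a generating sequence `X` of `K`-linear derivations of a
commutative `K`-algebra `A`, one has
`E^X_s(f·g) = ∑_{m=0}^{s} (E^X_m f)·(E^X_{s−m} g)` for all `s`, `f`, `g`: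
the Lie transform preserves products. -/
theorem lieTransform_mul {A : Type*} [CommRing A] [Algebra K A]
    (X : ℕ → Derivation K A A) (s : ℕ) (f g : A) :
    Eseq (fun j => (X j).toLinearMap) s (f * g) =
      ∑ m ∈ Finset.range (s + 1),
        Eseq (fun j => (X j).toLinearMap) m f *
          Eseq (fun j => (X j).toLinearMap) (s - m) g := by
  rw [Eseq_derivation_mul, Finset.Nat.sum_antidiagonal_eq_sum_range_succ_mk]
end

section
/- Let φ_1, φ_2, … be an arbitrary sequence of polynomial vector fields (φ_s : Fin n → MvPolynomial over K). Define the generating sequence X recursively by X_1 = φ_1 and, for r ≥ 2, X_r = φ_r − (the vector field whose j-th component is Σ_{k=1}^{r−1} (k/r) · L_{X_k}(E^X_{r−k}(x_j))), where x_j denotes the j-th coordinate polynomial. Then for every s ≥ 1 and every j one has E^X_s(x_j) = φ_{s,j}; that is, every formal near-the-identity transformation y_j = x_j + Σ_{s≥1} φ_{s,j}(x) is realized as the Lie transform y = T_X x of the coordinates. -/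
open Finset

variable {K : Type*} [Field K] [CharZero K] {n : ℕ}

/-- The Lie derivative `L_v f = ∑_j v_j ∂f/∂x_j` along a polynomial vector
field `v`, as a `K`-linear endomorphism of `K[x_1,…,x_n]`. -/
noncomputable def lieD (v : Fin n → MvPolynomial (Fin n) K) :
    Module.End K (MvPolynomial (Fin n) K) :=
  ∑ j, v j • (MvPolynomial.pderiv j).toLinearMap

/-- given an arbitrary sequence `φ_1, φ_2, …` of polynomial
vector fields, the generating sequence `X` defined by `X_1 = φ_1` and
`X_r = φ_r − ∑_{k=1}^{r−1} (k/r) • L_{X_k}(E^X_{r−k}(x_j))` (componentwise, `r ≥ 2`)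
satisfies `E^X_s(x_j) = φ_{s,j}` for every `s ≥ 1` and every `j`: every formal
near-the-identity transformation is realized as a Lie transform of the coordinates. -/
theorem near_identity_as_lieTransform
    (φ : ℕ → Fin n → MvPolynomial (Fin n) K)
    (X : ℕ → Fin n → MvPolynomial (Fin n) K)
    (hX1 : X 1 = φ 1)
    (hXr : ∀ r : ℕ, 2 ≤ r → ∀ j : Fin n, X r j = φ r j -
      ∑ k ∈ Finset.Icc 1 (r - 1), ((k : K) / (r : K)) •
        (lieD (X k)) (Eseq (fun i => lieD (X i)) (r - k) (MvPolynomial.X j)))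
    (s : ℕ) (hs : 1 ≤ s) (j : Fin n) :
    Eseq (fun i => lieD (X i)) s (MvPolynomial.X j) = φ s j := by
  have lieD_X (v : Fin n → MvPolynomial (Fin n) K) : lieD v (MvPolynomial.X j) = v j := by
    simp [lieD, MvPolynomial.pderiv_X, Pi.single_apply]
  obtain ⟨r, rfl⟩ : ∃ r, s = r + 1 := ⟨s - 1, by omega⟩
  have hr : (r : K) + 1 ≠ 0 := by exact_mod_cast r.succ_ne_zero
  have expand : Eseq (fun i => lieD (X i)) (r + 1) (MvPolynomial.X j) =
      X (r + 1) j + ∑ k ∈ Finset.Icc 1 r, ((k : K) / ((r + 1 : ℕ) : K)) •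
        (lieD (X k)) (Eseq (fun i => lieD (X i)) (r + 1 - k) (MvPolynomial.X j)) := by
    have shift : Finset.Icc 1 r = (Finset.range r).map (addRightEmbedding 1) := by
      ext k
      simp only [mem_Icc, mem_map, mem_range, addRightEmbedding_apply]
      exact ⟨fun h => ⟨k - 1, by omega, by omega⟩, by rintro ⟨i, hi, rfl⟩; omega⟩
    rw [Eseq, Finset.sum_range_succ, Nat.sub_self, Eseq, shift, Finset.sum_map]
    simp only [LinearMap.smul_apply, LinearMap.add_apply, LinearMap.sum_apply, mul_one,
      Module.End.mul_apply, lieD_X, smul_add, smul_smul, inv_mul_cancel₀ hr, one_smul,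
      Finset.smul_sum, addRightEmbedding_apply, Nat.add_sub_add_right, Nat.cast_add,
      Nat.cast_one, div_eq_inv_mul]
    exact add_comm _ _
  rw [expand]
  rcases Nat.eq_zero_or_pos r with rfl | h
  · simp [hX1]
  · rw [hXr (r + 1) (by omega) j, Nat.add_sub_cancel, sub_add_cancel]
end

section
/- Let ψ be a K-algebra automorphism of K[x_1,…,x_n] (the substitution operator of an invertible unperturbed map) and let f_1, f_2, … be an arbitrary sequence of n-tuples of polynomials. Then there exists a generating sequence V of polynomial vector fields such that for all s ≥ 1 and all j one has ψ(E^V_s(x_j)) = f_{s,j}; moreover, setting W_s = ψ ∘ L_{V_s} ∘ ψ^{−1} (a derivation of K[x_1,…,x_n]), one has ψ ∘ E^V_s = E^W_s ∘ ψ for all s ≥ 0. That is, the perturbed map x′ = ψ(x) + Σ_s f_s admits both representations x′ = (ψ ∘ T_V) x and x′ = (T_W ∘ ψ) x. -/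
open Finset

variable {K : Type*} [Field K] [CharZero K] {n : ℕ}

theorem Eseq_zero {V : Type*} [AddCommGroup V] [Module K V] (L : ℕ → Module.End K V) :
    Eseq L 0 = 1 := by
  rw [Eseq]

theorem Eseq_succ {V : Type*} [AddCommGroup V] [Module K V] (L : ℕ → Module.End K V) (s : ℕ) :
    Eseq L (s + 1) = ((s + 1 : K))⁻¹ • ∑ j ∈ Finset.range (s + 1),
      ((j + 1 : K)) • (L (j + 1) * Eseq L (s - j)) := by
  rw [Eseq]

/-- The part of `Eseq L (s + 1)` that does not involve `L (s + 1)`. -/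
noncomputable def EseqLower {V : Type*} [AddCommGroup V] [Module K V]
    (L : ℕ → Module.End K V) (s : ℕ) : Module.End K V :=
  ((s + 1 : K))⁻¹ • ∑ j ∈ Finset.range s, ((j + 1 : K)) • (L (j + 1) * Eseq L (s - j))

theorem Eseq_succ_eq_add {V : Type*} [AddCommGroup V] [Module K V]
    (L : ℕ → Module.End K V) (s : ℕ) :
    Eseq L (s + 1) = EseqLower L s + L (s + 1) := by
  have hs : (s + 1 : K) ≠ 0 := by exact_mod_cast s.succ_ne_zero
  rw [Eseq_succ, sum_range_succ, smul_add, Nat.sub_self, Eseq_zero, mul_one,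
    inv_smul_smul₀ hs, EseqLower]

/-- `Eseq L s` depends only on `L 1, …, L s`. -/
theorem Eseq_congr {V : Type*} [AddCommGroup V] [Module K V] {L L' : ℕ → Module.End K V}
    (s : ℕ) (h : ∀ i ≤ s, L i = L' i) : Eseq L s = Eseq L' s := by
  induction s using Nat.strong_induction_on with
  | _ s ih =>
    cases s with
    | zero => rw [Eseq_zero, Eseq_zero]
    | succ s =>
      rw [Eseq_succ, Eseq_succ]
      congr 1
      refine sum_congr rfl fun j hj => ?_
      rw [mem_range] at hj
      rw [h (j + 1) (by omega), ih (s - j) (by omega) fun i hi => h i (by omega)]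

theorem EseqLower_congr {V : Type*} [AddCommGroup V] [Module K V] {L L' : ℕ → Module.End K V}
    (s : ℕ) (h : ∀ i ≤ s, L i = L' i) : EseqLower L s = EseqLower L' s := by
  rw [EseqLower, EseqLower]
  congr 1
  refine sum_congr rfl fun j hj => ?_
  rw [mem_range] at hj
  rw [h (j + 1) (by omega), Eseq_congr (s - j) fun i hi => h i (by omega)]

/-- Conjugating the generating sequence conjugates the operators `Eseq`. -/
theorem mul_Eseq_eq_Eseq_conj_mul {V : Type*} [AddCommGroup V] [Module K V]
    {P Q : Module.End K V} (h : Q * P = 1) (L : ℕ → Module.End K V) (s : ℕ) :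
    P * Eseq L s = Eseq (fun i => P * L i * Q) s * P := by
  induction s using Nat.strong_induction_on with
  | _ s ih =>
    cases s with
    | zero => rw [Eseq_zero, Eseq_zero, mul_one, one_mul]
    | succ s =>
      rw [Eseq_succ, Eseq_succ, mul_smul_comm, smul_mul_assoc, mul_sum, sum_mul]
      congr 1
      refine sum_congr rfl fun j _ => ?_
      rw [mul_smul_comm, smul_mul_assoc, mul_assoc _ _ P, ← ih (s - j) (by omega)]
      congr 1
      simp only [mul_assoc]
      rw [← mul_assoc Q P, h, one_mul]

theorem lieD_X (v : Fin n → MvPolynomial (Fin n) K) (j : Fin n) :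
    lieD v (MvPolynomial.X j) = v j := by
  simp [lieD, LinearMap.sum_apply, MvPolynomial.pderiv_X, Pi.single_apply]

/-- The generating sequence whose Lie transform sends `x_j` to `x_j + ∑_s g_{s,j}`. -/
noncomputable def generator (g : ℕ → Fin n → MvPolynomial (Fin n) K) :
    ℕ → Fin n → MvPolynomial (Fin n) K
  | 0 => 0
  | s + 1 => fun j => g (s + 1) j -
      EseqLower (fun i => if _h : i < s + 1 then lieD (generator g i) else 0) s
        (MvPolynomial.X j)
  termination_by s => s

theorem Eseq_generator_X (g : ℕ → Fin n → MvPolynomial (Fin n) K) {s : ℕ} (hs : 1 ≤ s)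
    (j : Fin n) :
    Eseq (fun i => lieD (generator g i)) s (MvPolynomial.X j) = g s j := by
  obtain ⟨s, rfl⟩ := Nat.exists_eq_add_of_le' hs
  rw [Eseq_succ_eq_add, LinearMap.add_apply, lieD_X, generator,
    EseqLower_congr s (L' := fun i => if _h : i < s + 1 then lieD (generator g i) else 0)
      fun i hi => by rw [dif_pos (Nat.lt_succ_of_le hi)]]
  exact add_sub_cancel _ _

/-- for an algebra automorphism `ψ` of `K[x_1,…,x_n]` (the
substitution operator of the invertible unperturbed map) and an arbitrary
sequence `f_1, f_2, …` of `n`-tuples of polynomials, there is a generating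
sequence `V` of polynomial vector fields with `ψ(E^V_s(x_j)) = f_{s,j}` for all
`s ≥ 1`, `j`; moreover, with `W_s = ψ ∘ L_{V_s} ∘ ψ⁻¹`, one has
`ψ ∘ E^V_s = E^W_s ∘ ψ` for all `s ≥ 0`.  Thus the perturbed map
`x′ = ψ(x) + ∑_s f_s` admits both representations `x′ = (ψ ∘ T_V) x` and
`x′ = (T_W ∘ ψ) x`. -/
theorem perturbed_map_representation
    (ψ : MvPolynomial (Fin n) K ≃ₐ[K] MvPolynomial (Fin n) K)
    (f : ℕ → Fin n → MvPolynomial (Fin n) K) :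
    ∃ V : ℕ → Fin n → MvPolynomial (Fin n) K,
      (∀ s : ℕ, 1 ≤ s → ∀ j : Fin n,
        ψ (Eseq (fun i => lieD (V i)) s (MvPolynomial.X j)) = f s j) ∧
      (∀ s : ℕ,
        (ψ.toLinearMap : Module.End K (MvPolynomial (Fin n) K)) *
            Eseq (fun i => lieD (V i)) s =
          Eseq (fun i =>
              (ψ.toLinearMap : Module.End K (MvPolynomial (Fin n) K)) *
                lieD (V i) *
                (ψ.symm.toLinearMap : Module.End K (MvPolynomial (Fin n) K))) s *
            (ψ.toLinearMap : Module.End K (MvPolynomial (Fin n) K))) := by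
  refine ⟨generator fun s j => ψ.symm (f s j), fun s hs j => ?_, fun s => ?_⟩
  · rw [Eseq_generator_X _ hs, AlgEquiv.apply_symm_apply]
  · exact mul_Eseq_eq_Eseq_conj_mul (LinearMap.ext fun p => ψ.symm_apply_apply p) _ s
end

section
/- Let λ_1,…,λ_n be nonzero complex numbers satisfying the nonresonance condition: λ^k ≠ λ_j for every k ∈ ℕ^n with |k| = Σ_l k_l ≥ 2 and every j ∈ {1,…,n}. Let D = R − 1, where (R v)_j = λ_j^{−1} v_j(λ_1 x_1,…,λ_n x_n). Then for every s ≥ 1 and every polynomial vector field Ψ all of whose components are homogeneous of degree s+1, there exists a unique polynomial vector field X with all components homogeneous of degree s+1 such that D X = Ψ; its coefficients are given by X_{j,k} = Ψ_{j,k} / (λ^k/λ_j − 1). -/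
open Finset

/-- The operator `R` of the diagonal linear map:
`(R v)_j = λ_j⁻¹ · v_j(λ_1 x_1, …, λ_n x_n)`. -/
noncomputable def Rmap {n : ℕ} (lam : Fin n → ℂ)
    (v : Fin n → MvPolynomial (Fin n) ℂ) : Fin n → MvPolynomial (Fin n) ℂ :=
  fun j => (lam j)⁻¹ •
    MvPolynomial.aeval (fun l => MvPolynomial.C (lam l) * MvPolynomial.X l) (v j)

/-- `D = R − 1` acting on polynomial vector fields. -/
noncomputable def Dmap {n : ℕ} (lam : Fin n → ℂ)
    (v : Fin n → MvPolynomial (Fin n) ℂ) : Fin n → MvPolynomial (Fin n) ℂ :=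
  Rmap lam v - v

theorem coeff_aeval_C_mul_X {σ R : Type*} [CommSemiring R] [Fintype σ] (c : σ → R)
    (p : MvPolynomial σ R) (k : σ →₀ ℕ) :
    MvPolynomial.coeff k
        (MvPolynomial.aeval (fun l => MvPolynomial.C (c l) * MvPolynomial.X l) p) =
      (∏ l, c l ^ k l) * MvPolynomial.coeff k p := by
  classical
  induction p using MvPolynomial.induction_on' with
  | monomial m a =>
    have hmon : MvPolynomial.aeval (fun l => MvPolynomial.C (c l) * MvPolynomial.X l)
        (MvPolynomial.monomial m a) =
          MvPolynomial.C (∏ l, c l ^ m l) * MvPolynomial.monomial m a := by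
      rw [MvPolynomial.aeval_monomial, MvPolynomial.monomial_eq,
        Finsupp.prod_fintype _ _ fun _ => pow_zero _,
        Finsupp.prod_fintype _ _ fun _ => pow_zero _]
      simp only [mul_pow, Finset.prod_mul_distrib, map_prod, map_pow,
        MvPolynomial.algebraMap_eq]
      ring
    rw [hmon, MvPolynomial.coeff_C_mul, MvPolynomial.coeff_monomial]
    split_ifs with h
    · rw [h]
    · simp
  | add p q hp hq => simp only [map_add, MvPolynomial.coeff_add, hp, hq, mul_add]

theorem coeff_Dmap {n : ℕ} (lam : Fin n → ℂ) (v : Fin n → MvPolynomial (Fin n) ℂ)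
    (j : Fin n) (k : Fin n →₀ ℕ) :
    MvPolynomial.coeff k (Dmap lam v j) =
      ((∏ l, lam l ^ k l) / lam j - 1) * MvPolynomial.coeff k (v j) := by
  simp only [Dmap, Rmap, Pi.sub_apply, MvPolynomial.coeff_sub, MvPolynomial.coeff_smul,
    coeff_aeval_C_mul_X, smul_eq_mul]
  ring

theorem exists_coeff_eq_mul {σ R : Type*} [CommSemiring R] (p : MvPolynomial σ R)
    (f : (σ →₀ ℕ) → R) :
    ∃ q : MvPolynomial σ R, ∀ k, MvPolynomial.coeff k q = f k * MvPolynomial.coeff k p := by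
  classical
  refine ⟨∑ m ∈ p.support, MvPolynomial.monomial m (f m * MvPolynomial.coeff m p), fun k => ?_⟩
  simp only [MvPolynomial.coeff_sum, MvPolynomial.coeff_monomial, Finset.sum_ite_eq',
    MvPolynomial.mem_support_iff]
  split_ifs with h
  · rfl
  · rw [not_not.mp h, mul_zero]

/-- under the nonresonance condition `λ^k ≠ λ_j` for `|k| ≥ 2`,
for every `s ≥ 1` and every vector field `Ψ` homogeneous of degree `s+1` there
is a unique vector field `X` homogeneous of degree `s+1` with `D X = Ψ`, and
its coefficients are `X_{j,k} = Ψ_{j,k} / (λ^k/λ_j − 1)`. -/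
theorem Dmap_solvable {n : ℕ} (lam : Fin n → ℂ) (hlam : ∀ j, lam j ≠ 0)
    (hnr : ∀ k : Fin n →₀ ℕ, 2 ≤ ∑ l, k l → ∀ j : Fin n,
      (∏ l, lam l ^ k l) ≠ lam j)
    (s : ℕ) (hs : 1 ≤ s) (Ψ : Fin n → MvPolynomial (Fin n) ℂ)
    (hΨ : ∀ j, (Ψ j).IsHomogeneous (s + 1)) :
    (∃! X : Fin n → MvPolynomial (Fin n) ℂ,
      (∀ j, (X j).IsHomogeneous (s + 1)) ∧ Dmap lam X = Ψ) ∧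
    (∀ X : Fin n → MvPolynomial (Fin n) ℂ,
      (∀ j, (X j).IsHomogeneous (s + 1)) ∧ Dmap lam X = Ψ →
        ∀ (j : Fin n) (k : Fin n →₀ ℕ),
          MvPolynomial.coeff k (X j) =
            MvPolynomial.coeff k (Ψ j) / ((∏ l, lam l ^ k l) / lam j - 1)) := by
  have hne : ∀ (j : Fin n) (k : Fin n →₀ ℕ), k.degree = s + 1 →
      (∏ l, lam l ^ k l) / lam j - 1 ≠ 0 := fun j k hk => by
    rw [sub_ne_zero, Ne, div_eq_one_iff_eq (hlam j)]
    refine hnr k ?_ j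
    rw [← Finsupp.degree_eq_sum]
    omega
  have hcoeff : ∀ X : Fin n → MvPolynomial (Fin n) ℂ,
      (∀ j, (X j).IsHomogeneous (s + 1)) ∧ Dmap lam X = Ψ →
        ∀ (j : Fin n) (k : Fin n →₀ ℕ),
          MvPolynomial.coeff k (X j) =
            MvPolynomial.coeff k (Ψ j) / ((∏ l, lam l ^ k l) / lam j - 1) := by
    rintro X ⟨hX, rfl⟩ j k
    by_cases hk : k.degree = s + 1
    · rw [coeff_Dmap, mul_div_cancel_left₀ _ (hne j k hk)]
    · rw [(hX j).coeff_eq_zero hk, (hΨ j).coeff_eq_zero hk, zero_div]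
  refine ⟨?_, hcoeff⟩
  choose X hX using fun j =>
    exists_coeff_eq_mul (Ψ j) fun k => ((∏ l, lam l ^ k l) / lam j - 1)⁻¹
  have hXhom : ∀ j, (X j).IsHomogeneous (s + 1) := fun j k hk => by
    rw [hX] at hk
    exact hΨ j (right_ne_zero_of_mul hk)
  refine ⟨X, ⟨hXhom, ?_⟩, fun Y hY => ?_⟩
  · ext j k
    rw [coeff_Dmap, hX]
    by_cases hk : k.degree = s + 1
    · rw [mul_inv_cancel_left₀ (hne j k hk)]
    · rw [(hΨ j).coeff_eq_zero hk, mul_zero, mul_zero]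
  · ext j k
    rw [hcoeff Y hY, hX, div_eq_inv_mul]
end
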